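/- Let n ≥ 1, m ≥ 2, let X be an n×n integer matrix with all entries in {-1, 0, 1}, and let Z = (z_{i,j}) be an m×m integer matrix with all entries in {-1, 0, 1} satisfying z_{m,m} = 0. Let W be the (m+n-1)×(m+n-1) matrix defined by w_{i,j} = z_{i,j} for 1 ≤ i ≤ m−1 and 1 ≤ j ≤ m; w_{i,j} = 0 for 1 ≤ i ≤ m−1 and j > m; w_{m,j} = z_{m,j} for 1 ≤ j ≤ m−1; w_{m+i−1, m+j−1} = x_{i,j} for 1 ≤ i, j ≤ n; and w_{i,j} = 0 for i > m and j ≤ m−1. If Per(W) = 0, then Per(Z^{m,m})·Per(X) = −Per(Z)·Per(X^{1,1}). -/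

import Mathlib

/-- The minor of a square matrix obtained by deleting row `i` and column `j`. -/
def matMinor {n : ℕ} (M : Matrix (Fin (n + 1)) (Fin (n + 1)) ℤ) (i j : Fin (n + 1)) :
    Matrix (Fin n) (Fin n) ℤ :=
  M.submatrix i.succAbove j.succAbove

/-- The `(m+n-1) × (m+n-1)` matrix `W` built (in 0-based indexing) from an `m × m` matrix `Z`
(with `m = μ+2`) and an `n × n` matrix `X` (with `n = ν+1`). -/
def blockW (μ ν : ℕ) (Z : Matrix (Fin (μ + 2)) (Fin (μ + 2)) ℤ)
    (X : Matrix (Fin (ν + 1)) (Fin (ν + 1)) ℤ) :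
    Matrix (Fin (μ + ν + 2)) (Fin (μ + ν + 2)) ℤ :=
  fun i j =>
    if hi : (i : ℕ) < μ + 1 then
      if hj : (j : ℕ) < μ + 2 then Z ⟨i, by omega⟩ ⟨j, hj⟩ else 0
    else
      if hj : (j : ℕ) < μ + 1 then
        if (i : ℕ) = μ + 1 then Z ⟨μ + 1, by omega⟩ ⟨j, by omega⟩ else 0
      else
        X ⟨(i : ℕ) - (μ + 1), by have := i.isLt; omega⟩
          ⟨(j : ℕ) - (μ + 1), by have := j.isLt; omega⟩

namespace Matrix

variable {R m n : Type*} [CommSemiring R] [DecidableEq m] [Fintype m] [DecidableEq n] [Fintype n]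

theorem permanent_submatrix_equiv_self (e : n ≃ m) (A : Matrix m m R) :
    (A.submatrix e e).permanent = A.permanent := by
  refine Fintype.sum_equiv e.permCongr _ _ fun σ => ?_
  exact Fintype.prod_equiv e _ _ fun i => by simp [Equiv.permCongr_apply]

theorem permanent_updateCol_add (M : Matrix n n R) (j : n) (u v : n → R) :
    (M.updateCol j (u + v)).permanent =
      (M.updateCol j u).permanent + (M.updateCol j v).permanent := by
  simp only [permanent, ← Finset.mul_prod_erase _ _ (Finset.mem_univ j), updateCol_self,
    Pi.add_apply, ← Finset.sum_add_distrib, add_mul]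
  refine Finset.sum_congr rfl fun σ _ => ?_
  congr 2 <;>
  exact Finset.prod_congr rfl fun i hi => by
    simp only [updateCol_ne (Finset.ne_of_mem_erase hi)]

theorem permanent_updateRow_add (M : Matrix n n R) (i : n) (u v : n → R) :
    (M.updateRow i (u + v)).permanent =
      (M.updateRow i u).permanent + (M.updateRow i v).permanent := by
  simp only [← permanent_transpose (M.updateRow i _), ← updateCol_transpose,
    permanent_updateCol_add]

theorem permanent_fromBlocks_zero₂₁ (A : Matrix m m R) (B : Matrix m n R) (D : Matrix n n R) :
    (fromBlocks A B 0 D).permanent = A.permanent * D.permanent := by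
  have h_range : ∑ σ ∈ Finset.univ.map
        ⟨Equiv.Perm.sumCongrHom m n, Equiv.Perm.sumCongrHom_injective⟩,
        ∏ i, fromBlocks A B 0 D (σ i) i = (fromBlocks A B 0 D).permanent := by
    refine Finset.sum_subset (Finset.subset_univ _) fun σ _ hσ => ?_
    have h_maps : ¬ Set.MapsTo σ (Set.range Sum.inl) (Set.range Sum.inl) := fun h => by
      obtain ⟨τ, hτ⟩ := Equiv.Perm.mem_sumCongrHom_range_of_perm_mapsTo_inl h
      exact hσ (Finset.mem_map.2 ⟨τ, Finset.mem_univ _, hτ⟩)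
    simp only [Set.MapsTo, Set.forall_mem_range, not_forall] at h_maps
    obtain ⟨a, ha⟩ := h_maps
    refine Finset.prod_eq_zero (Finset.mem_univ (Sum.inl a)) ?_
    rcases hx : σ (Sum.inl a) with b | b
    · exact absurd ⟨b, hx.symm⟩ ha
    · rfl
  rw [← h_range, Finset.sum_map, Fintype.sum_prod_type, permanent, permanent, Finset.sum_mul_sum]
  simp

theorem permanent_fromBlocks_zero₁₂ (A : Matrix m m R) (C : Matrix n m R) (D : Matrix n n R) :
    (fromBlocks A 0 C D).permanent = A.permanent * D.permanent := by
  rw [← permanent_transpose, fromBlocks_transpose, transpose_zero, permanent_fromBlocks_zero₂₁,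
    permanent_transpose, permanent_transpose]

end Matrix

section entries

variable {ν μ : ℕ} {Z : Matrix (Fin (μ + 2)) (Fin (μ + 2)) ℤ}
  {X : Matrix (Fin (ν + 1)) (Fin (ν + 1)) ℤ} {i j : Fin (μ + ν + 2)}

theorem blockW_eq_left {a b : Fin (μ + 2)} (hi : (i : ℕ) = a) (hj : (j : ℕ) = b)
    (h : (a : ℕ) < μ + 1 ∨ (b : ℕ) < μ + 1) : blockW μ ν Z X i j = Z a b := by
  obtain ⟨a, ha⟩ := a
  obtain ⟨b, hb⟩ := b
  dsimp only at hi hj h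
  subst hi hj
  by_cases hi : (i : ℕ) < μ + 1
  · simp [blockW, hi, hb]
  · have hj : (j : ℕ) < μ + 1 := by omega
    have hi : (i : ℕ) = μ + 1 := by omega
    simp only [blockW, hi, hj, lt_irrefl, dite_true, dite_false, if_true]

theorem blockW_eq_right {a b : Fin (ν + 1)} (hi : (i : ℕ) = μ + 1 + a)
    (hj : (j : ℕ) = μ + 1 + b) : blockW μ ν Z X i j = X a b := by
  simp [blockW, hi, hj, show ¬ μ + 1 + (a : ℕ) ≤ μ by omega, show ¬ μ + 1 + (b : ℕ) ≤ μ by omega]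

theorem blockW_eq_zero_of_lt_of_le (hi : (i : ℕ) < μ + 1) (hj : μ + 2 ≤ (j : ℕ)) :
    blockW μ ν Z X i j = 0 := by
  simp only [blockW, hi, hj.not_gt, dite_true, dite_false]

theorem blockW_eq_zero_of_le_of_lt (hi : μ + 2 ≤ (i : ℕ)) (hj : (j : ℕ) < μ + 1) :
    blockW μ ν Z X i j = 0 := by
  simp only [blockW, show ¬ (i : ℕ) < μ + 1 by omega, show (i : ℕ) ≠ μ + 1 by omega, hj,
    dite_true, dite_false, if_false]

end entries

/-- The glueing formula for the permanent of `blockW`: split the row shared by `Z` and `X` into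
its `Z`-part and its `X`-part. -/
theorem permanent_blockW (ν μ : ℕ) (X : Matrix (Fin (ν + 1)) (Fin (ν + 1)) ℤ)
    (Z : Matrix (Fin (μ + 2)) (Fin (μ + 2)) ℤ)
    (hZ0 : Z (Fin.last (μ + 1)) (Fin.last (μ + 1)) = 0) :
    (blockW μ ν Z X).permanent =
      (matMinor Z (Fin.last (μ + 1)) (Fin.last (μ + 1))).permanent * X.permanent +
        Z.permanent * (matMinor X 0 0).permanent := by
  let W := blockW μ ν Z X
  let r : Fin (μ + ν + 2) := ⟨μ + 1, by omega⟩
  let x : Fin (μ + ν + 2) → ℤ := fun j => if (j : ℕ) < μ + 1 then 0 else W r j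
  let z : Fin (μ + ν + 2) → ℤ := fun j => if (j : ℕ) < μ + 1 then W r j else 0
  have h_split : W = W.updateRow r (x + z) := by
    rw [show x + z = W r by ext j; simp only [x, z, Pi.add_apply]; split_ifs <;> simp,
      Matrix.updateRow_eq_self]
  let e : Fin (μ + 1) ⊕ Fin (ν + 1) ≃ Fin (μ + ν + 2) :=
    finSumFinEquiv.trans (finCongr (by omega))
  let f : Fin (μ + 2) ⊕ Fin ν ≃ Fin (μ + ν + 2) :=
    finSumFinEquiv.trans (finCongr (by omega))
  have hx : (W.updateRow r x).submatrix e e =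
      Matrix.fromBlocks (matMinor Z (Fin.last (μ + 1)) (Fin.last (μ + 1)))
        ((W.updateRow r x).submatrix e e).toBlocks₁₂ 0 X := by
    ext (i | i) (j | j)
    · have h : (e (Sum.inl i) : ℕ) = i := by simp [e]
      have h' : (e (Sum.inl j) : ℕ) = j := by simp [e]
      rw [Matrix.submatrix_apply, Matrix.updateRow_ne (by simp [Fin.ext_iff, r, h, i.isLt.ne])]
      exact blockW_eq_left (by simp [h]) (by simp [h'])
        (.inl (by rw [Fin.succAbove_last]; exact i.isLt))
    · rfl
    · have h : (e (Sum.inr i) : ℕ) = μ + 1 + i := by simp [e]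
      have h' : (e (Sum.inl j) : ℕ) = j := by simp [e]
      rw [Matrix.submatrix_apply, Matrix.updateRow_apply]
      split_ifs with hr
      · exact if_pos (by omega)
      · have hi : (e (Sum.inr i) : ℕ) ≠ μ + 1 := fun hi => hr (Fin.ext hi)
        exact blockW_eq_zero_of_le_of_lt (by omega) (by omega)
    · have h : (e (Sum.inr i) : ℕ) = μ + 1 + i := by simp [e]
      have h' : (e (Sum.inr j) : ℕ) = μ + 1 + j := by simp [e]
      rw [Matrix.submatrix_apply, Matrix.updateRow_apply]
      split_ifs with hr
      · exact (if_neg (by omega)).trans (hr ▸ blockW_eq_right h h')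
      · exact blockW_eq_right h h'
  have hz : (W.updateRow r z).submatrix f f =
      Matrix.fromBlocks Z 0 ((W.updateRow r z).submatrix f f).toBlocks₂₁ (matMinor X 0 0) := by
    ext (i | i) (j | j)
    · have h : (f (Sum.inl i) : ℕ) = i := by simp [f]
      have h' : (f (Sum.inl j) : ℕ) = j := by simp [f]
      rw [Matrix.submatrix_apply, Matrix.updateRow_apply, Matrix.fromBlocks_apply₁₁]
      split_ifs with hr
      · have hi : i = Fin.last (μ + 1) := Fin.ext (h.symm.trans (congrArg Fin.val hr))
        by_cases hlt : (j : ℕ) < μ + 1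
        · exact (if_pos (by omega)).trans (hr ▸ blockW_eq_left h h' (.inr hlt))
        · have hj : j = Fin.last (μ + 1) := Fin.ext (by simp; omega)
          exact (if_neg (by rwa [h'])).trans (by rw [hi, hj, hZ0])
      · have hi : (f (Sum.inl i) : ℕ) ≠ μ + 1 := fun hi => hr (Fin.ext hi)
        exact blockW_eq_left h h' (.inl (by omega))
    · have h : (f (Sum.inl i) : ℕ) = i := by simp [f]
      have h' : (f (Sum.inr j) : ℕ) = μ + 2 + j := by simp [f]
      rw [Matrix.submatrix_apply, Matrix.updateRow_apply]
      split_ifs with hr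
      · exact if_neg (by omega)
      · have hi : (f (Sum.inl i) : ℕ) ≠ μ + 1 := fun hi => hr (Fin.ext hi)
        exact blockW_eq_zero_of_lt_of_le (by omega) (by omega)
    · rfl
    · have h : (f (Sum.inr i) : ℕ) = μ + 2 + i := by simp [f]
      have h' : (f (Sum.inr j) : ℕ) = μ + 2 + j := by simp [f]
      rw [Matrix.submatrix_apply, Matrix.updateRow_ne (by simp [Fin.ext_iff, r, h]; omega)]
      exact blockW_eq_right (by simp [h]; omega) (by simp [h']; omega)
  change W.permanent = _
  rw [h_split, Matrix.permanent_updateRow_add, ← Matrix.permanent_submatrix_equiv_self e, hx,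
    Matrix.permanent_fromBlocks_zero₂₁, ← Matrix.permanent_submatrix_equiv_self f (W.updateRow r z),
    hz, Matrix.permanent_fromBlocks_zero₁₂]

/-- With `X` of size `ν+1 ≥ 1`, `Z` of size `μ+2 ≥ 2`, both with entries in
`{-1, 0, 1}` and the bottom-right entry of `Z` equal to `0`: if the combined matrix `W` has
permanent `0`, then `Per(Z^{m,m})·Per(X) = -Per(Z)·Per(X^{1,1})`. -/
theorem stmt3 (ν μ : ℕ) (X : Matrix (Fin (ν + 1)) (Fin (ν + 1)) ℤ)
    (Z : Matrix (Fin (μ + 2)) (Fin (μ + 2)) ℤ)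
    (hX : ∀ i j, X i j = -1 ∨ X i j = 0 ∨ X i j = 1)
    (hZ : ∀ i j, Z i j = -1 ∨ Z i j = 0 ∨ Z i j = 1)
    (hZ0 : Z (Fin.last (μ + 1)) (Fin.last (μ + 1)) = 0)
    (hW : (blockW μ ν Z X).permanent = 0) :
    (matMinor Z (Fin.last (μ + 1)) (Fin.last (μ + 1))).permanent * X.permanent =
      -(Z.permanent * (matMinor X 0 0).permanent) := by
  linarith [permanent_blockW ν μ X Z hZ0]
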